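/- Let (X,d_X) and (Y,d_Y) be compact metric spaces, let f : X → X, g : Y → Y and π : X → Y be continuous maps with π surjective and π ∘ f = g ∘ π. If h(f, π⁻¹({y})) = 0 for every y ∈ Y, then h(f) = h(g), where h denotes topological entropy. -/

import Mathlib

open Set Filter

/-- A finite set `F` `(n,ε)`-spans `K` for the map `f`. -/
def Spans {X : Type*} [MetricSpace X] (f : X → X) (K : Set X) (F : Finset X)
    (n : ℕ) (ε : ℝ) : Prop :=
  ∀ y ∈ K, ∃ x ∈ F, ∀ i < n, dist (f^[i] x) (f^[i] y) < ε

/-- `N(n,ε,K)`: the minimal cardinality of an `(n,ε)`-spanning set of `K`. -/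
noncomputable def spanNum {X : Type*} [MetricSpace X] (f : X → X) (K : Set X)
    (n : ℕ) (ε : ℝ) : ℕ :=
  sInf {m : ℕ | ∃ F : Finset X, Spans f K F n ε ∧ F.card = m}

/-- The topological entropy of `f` on the set `K`:
`lim_{ε→0} limsup_n (1/n) log N(n,ε,K)`; since `N(n,ε,K)` is antitone in `ε`
the limit as `ε → 0` equals the supremum over `ε > 0`. -/
noncomputable def entropyOn {X : Type*} [MetricSpace X] (f : X → X) (K : Set X) : EReal :=
  ⨆ (ε : ℝ) (_ : 0 < ε),
    Filter.atTop.limsup fun n : ℕ => ((Real.log (spanNum f K n ε) / n : ℝ) : EReal)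

theorem Spans.spanNum_le_card {X : Type*} [MetricSpace X] {f : X → X} {K : Set X}
    {F : Finset X} {n : ℕ} {ε : ℝ} (h : Spans f K F n ε) : spanNum f K n ε ≤ F.card :=
  Nat.sInf_le ⟨F, h, rfl⟩

theorem isOpen_dynamicalBall {X : Type*} [MetricSpace X] {f : X → X} (hf : Continuous f)
    (x : X) (n : ℕ) (ε : ℝ) : IsOpen {y | ∀ i < n, dist (f^[i] x) (f^[i] y) < ε} := by
  have : {y | ∀ i < n, dist (f^[i] x) (f^[i] y) < ε} =
      ⋂ i ∈ Finset.range n, {y | dist (f^[i] x) (f^[i] y) < ε} := by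
    ext y; simp
  rw [this]
  exact isOpen_biInter_finset fun i _ =>
    isOpen_lt (continuous_const.dist (hf.iterate i)) continuous_const

theorem exists_spans_card_eq_spanNum {X : Type*} [MetricSpace X] [CompactSpace X] {f : X → X}
    (hf : Continuous f) (K : Set X) (n : ℕ) {ε : ℝ} (hε : 0 < ε) :
    ∃ F : Finset X, Spans f K F n ε ∧ F.card = spanNum f K n ε := by
  obtain ⟨t, ht⟩ := CompactSpace.elim_nhds_subcover
    (fun x => {y | ∀ i < n, dist (f^[i] x) (f^[i] y) < ε})
    fun x => (isOpen_dynamicalBall hf x n ε).mem_nhds fun i _ => by simpa using hε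
  refine Nat.sInf_mem (s := {m : ℕ | ∃ F : Finset X, Spans f K F n ε ∧ F.card = m})
    ⟨t.card, t, fun y _ => ?_, rfl⟩
  have hy : y ∈ ⋃ x ∈ t, {y | ∀ i < n, dist (f^[i] x) (f^[i] y) < ε} := ht ▸ mem_univ y
  simpa using hy

theorem entropyOn_univ_le_of_semiconj {X Y : Type*} [MetricSpace X] [CompactSpace X]
    [MetricSpace Y] {f : X → X} {g : Y → Y} {π : X → Y}
    (hf : Continuous f) (hπ : Continuous π)
    (hsurj : Function.Surjective π) (hcomm : Function.Semiconj π f g) :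
    entropyOn g univ ≤ entropyOn f univ := by
  classical
  refine iSup₂_le fun ε hε => ?_
  obtain ⟨δ, hδ, hδε⟩ :=
    Metric.uniformContinuous_iff.1 (CompactSpace.uniformContinuous_of_continuous hπ) ε hε
  refine le_trans ?_ (le_iSup₂ δ hδ)
  refine limsup_le_limsup (Eventually.of_forall fun n => ?_)
  obtain ⟨F, hF, hcard⟩ := exists_spans_card_eq_spanNum hf univ n hδ
  have hle : spanNum g univ n ε ≤ spanNum f univ n δ := by
    have hs : Spans g univ (F.image π) n ε := by
      intro y _
      obtain ⟨x, rfl⟩ := hsurj y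
      obtain ⟨z, hz, hzx⟩ := hF x trivial
      refine ⟨π z, Finset.mem_image_of_mem π hz, fun i hi => ?_⟩
      rw [← (hcomm.iterate_right i).eq, ← (hcomm.iterate_right i).eq]
      exact hδε (hzx i hi)
    exact hcard ▸ hs.spanNum_le_card.trans Finset.card_image_le
  have hlog : Real.log (spanNum g univ n ε) ≤ Real.log (spanNum f univ n δ) := by
    rcases Nat.eq_zero_or_pos (spanNum g univ n ε) with h | h
    · rw [h]; simpa using Real.log_natCast_nonneg _
    · exact Real.log_le_log (by exact_mod_cast h) (by exact_mod_cast hle)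
  exact EReal.coe_le_coe_iff.2 (by gcongr)

/-- A set with small entropy is spanned, at some positive time `m`, by at most `exp (α m)`
points. -/
theorem exists_spans_card_le_exp {X : Type*} [MetricSpace X] [CompactSpace X] {f : X → X}
    (hf : Continuous f) {K : Set X} {α : ℝ} (hK : entropyOn f K < α) {ε : ℝ} (hε : 0 < ε) :
    ∃ m : ℕ, 0 < m ∧ ∃ F : Finset X, Spans f K F m ε ∧ (F.card : ℝ) ≤ Real.exp (α * m) := by
  have hlim : atTop.limsup (fun n : ℕ => ((Real.log (spanNum f K n ε) / n : ℝ) : EReal)) < α :=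
    (le_iSup₂ (f := fun (ε : ℝ) (_ : 0 < ε) =>
      atTop.limsup fun n : ℕ => ((Real.log (spanNum f K n ε) / n : ℝ) : EReal)) ε hε).trans_lt hK
  obtain ⟨m, hm, hpos⟩ := ((eventually_lt_of_limsup_lt hlim).and (eventually_gt_atTop 0)).exists
  obtain ⟨F, hF, hcard⟩ := exists_spans_card_eq_spanNum hf K m hε
  refine ⟨m, hpos, F, hF, ?_⟩
  rw [EReal.coe_lt_coe_iff, div_lt_iff₀ (by exact_mod_cast hpos), ← hcard] at hm
  rcases Nat.eq_zero_or_pos F.card with h | h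
  · rw [h]; simpa using (Real.exp_pos _).le
  · exact (Real.log_le_iff_le_exp (by exact_mod_cast h)).1 hm.le

/-- If the preimage of every `δ`-ball is spanned at a time `m ∈ (0, M]` by at most `exp (α m)`
points, then the preimage of every dynamical ball `B(y, n, δ)` is covered by at most
`exp (α (n + M))` sets of dynamical diameter less than `2ε`. -/
theorem exists_cover_preimage_dynamicalBall {X Y : Type*} [MetricSpace X] [MetricSpace Y]
    {f : X → X} {g : Y → Y} {π : X → Y} (hcomm : Function.Semiconj π f g)
    {α δ ε : ℝ} (hα : 0 ≤ α) {M : ℕ}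
    (hloc : ∀ y, ∃ m : ℕ, 0 < m ∧ m ≤ M ∧ ∃ F : Finset X,
      Spans f (π ⁻¹' Metric.ball y δ) F m ε ∧ (F.card : ℝ) ≤ Real.exp (α * m)) (n : ℕ) :
    ∀ y, ∃ 𝒱 : Finset (Set X), (𝒱.card : ℝ) ≤ Real.exp (α * (n + M)) ∧
      (∀ x, (∀ i < n, dist (g^[i] y) (g^[i] (π x)) < δ) → ∃ V ∈ 𝒱, x ∈ V) ∧
      ∀ V ∈ 𝒱, ∀ x ∈ V, ∀ x' ∈ V, ∀ i < n, dist (f^[i] x) (f^[i] x') < 2 * ε := by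
  classical
  induction n using Nat.strong_induction_on with
  | _ n ih =>
  intro y
  rcases Nat.eq_zero_or_pos n with rfl | hn
  · refine ⟨{univ}, ?_, by simp, by simp⟩
    simpa using mul_nonneg hα (Nat.cast_nonneg M)
  obtain ⟨m, hm, hmM, F, hF, hcard⟩ := hloc y
  have hball : ∀ x, (∀ i < n, dist (g^[i] y) (g^[i] (π x)) < δ) →
      ∃ z ∈ F, ∀ i < m, dist (f^[i] z) (f^[i] x) < ε := fun x hx =>
    hF x (by simpa [dist_comm] using hx 0 hn)
  have hdiam : ∀ z x x' : X, (∀ i < m, dist (f^[i] z) (f^[i] x) < ε) →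
      (∀ i < m, dist (f^[i] z) (f^[i] x') < ε) →
      ∀ i < m, dist (f^[i] x) (f^[i] x') < 2 * ε := fun z x x' h h' i hi => by
    have := dist_triangle_left (f^[i] x) (f^[i] x') (f^[i] z)
    linarith [h i hi, h' i hi]
  rcases le_total n m with hnm | hmn
  · refine ⟨F.image fun z => {x | ∀ i < m, dist (f^[i] z) (f^[i] x) < ε}, ?_, ?_, ?_⟩
    · refine (Nat.cast_le.2 Finset.card_image_le).trans (hcard.trans (Real.exp_le_exp.2 ?_))
      have : (m : ℝ) ≤ M := by exact_mod_cast hmM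
      have : (0 : ℝ) ≤ n := n.cast_nonneg
      gcongr
      linarith
    · intro x hx
      obtain ⟨z, hz, hzx⟩ := hball x hx
      exact ⟨_, Finset.mem_image_of_mem _ hz, hzx⟩
    · intro V hV x hx x' hx' i hi
      obtain ⟨z, -, rfl⟩ := Finset.mem_image.1 hV
      exact hdiam z x x' hx hx' i (hi.trans_le hnm)
  · obtain ⟨𝒱, h𝒱card, h𝒱cov, h𝒱diam⟩ := ih (n - m) (by omega) (g^[m] y)
    refine ⟨Finset.image₂ (fun z V => {x | ∀ i < m, dist (f^[i] z) (f^[i] x) < ε} ∩ f^[m] ⁻¹' V)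
      F 𝒱, ?_, ?_, ?_⟩
    · calc _ ≤ ((F.card * 𝒱.card : ℕ) : ℝ) := Nat.cast_le.2 (Finset.card_image₂_le _ _ _)
        _ ≤ Real.exp (α * m) * Real.exp (α * ((n - m : ℕ) + M)) := by
          push_cast
          gcongr
        _ = _ := by
          rw [← Real.exp_add, Nat.cast_sub hmn]
          ring_nf
    · intro x hx
      obtain ⟨z, hz, hzx⟩ := hball x hx
      obtain ⟨V, hV, hxV⟩ := h𝒱cov (f^[m] x) fun i hi => by
        rw [(hcomm.iterate_right m).eq, ← Function.iterate_add_apply,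
          ← Function.iterate_add_apply]
        exact hx _ (by omega)
      exact ⟨_, Finset.mem_image₂_of_mem hz hV, hzx, hxV⟩
    · intro V hV x hx x' hx' i hi
      obtain ⟨z, -, V', hV', rfl⟩ := Finset.mem_image₂.1 hV
      rcases lt_or_ge i m with him | him
      · exact hdiam z x x' hx.1 hx'.1 i him
      · have := h𝒱diam V' hV' _ hx.2 _ hx'.2 (i - m) (by omega)
        rwa [← Function.iterate_add_apply, ← Function.iterate_add_apply,
          Nat.sub_add_cancel him] at this

theorem exists_spanNum_le_mul_exp {X Y : Type*} [MetricSpace X] [CompactSpace X]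
    [MetricSpace Y] [CompactSpace Y] {f : X → X} {g : Y → Y} {π : X → Y}
    (hf : Continuous f) (hg : Continuous g) (hπ : Continuous π)
    (hcomm : Function.Semiconj π f g) {α : ℝ} (hα : 0 ≤ α)
    (hfib : ∀ y, entropyOn f (π ⁻¹' {y}) < α) {ε : ℝ} (hε : 0 < ε) :
    ∃ δ > 0, ∃ M : ℕ, ∀ n : ℕ,
      (spanNum f univ n (2 * ε) : ℝ) ≤ spanNum g univ n δ * Real.exp (α * (n + M)) := by
  classical
  choose m hm F hF hcard using fun y => exists_spans_card_le_exp hf (hfib y) hε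
  let U : Y → Set X := fun y => ⋃ z ∈ F y, {x | ∀ i < m y, dist (f^[i] z) (f^[i] x) < ε}
  have hU : ∀ y, IsOpen (U y) := fun y =>
    isOpen_biUnion fun z _ => isOpen_dynamicalBall hf z (m y) ε
  let W : Y → Set Y := fun y => (π '' (U y)ᶜ)ᶜ
  have hW : ∀ y, IsOpen (W y) := fun y =>
    (hπ.isClosedMap _ (hU y).isClosed_compl).isOpen_compl
  have hyW : ∀ y, y ∈ W y := by
    rintro y ⟨x, hx, hxy⟩
    obtain ⟨z, hz, hzx⟩ := hF y x hxy
    exact hx (mem_iUnion₂.2 ⟨z, hz, hzx⟩)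
  obtain ⟨t, ht⟩ := CompactSpace.elim_nhds_subcover W fun y => (hW y).mem_nhds (hyW y)
  obtain ⟨δ, hδ, hleb⟩ := lebesgue_number_lemma_of_metric (isCompact_univ (X := Y))
    (c := fun y : t => W y) (fun y => hW y) (by
      intro y _
      have hy : y ∈ ⋃ x ∈ t, W x := ht ▸ mem_univ y
      simpa using hy)
  refine ⟨δ, hδ, t.sup m, fun n => ?_⟩
  have hloc : ∀ y, ∃ k : ℕ, 0 < k ∧ k ≤ t.sup m ∧ ∃ F : Finset X,
      Spans f (π ⁻¹' Metric.ball y δ) F k ε ∧ (F.card : ℝ) ≤ Real.exp (α * k) := by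
    intro y
    obtain ⟨c, hc⟩ := hleb y trivial
    refine ⟨m c, hm c, Finset.le_sup c.2, F c, fun x hx => ?_, hcard c⟩
    have hxU : x ∈ U c := by
      by_contra h
      exact hc hx ⟨x, h, rfl⟩
    simpa [U] using hxU
  choose 𝒱 h𝒱card h𝒱cov h𝒱diam using
    exists_cover_preimage_dynamicalBall hcomm hα hloc n
  obtain ⟨E, hE, hEcard⟩ := exists_spans_card_eq_spanNum hg univ n hδ
  rcases isEmpty_or_nonempty X with hX | hX
  · have h0 : spanNum f univ n (2 * ε) ≤ (∅ : Finset X).card :=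
      Spans.spanNum_le_card fun y => isEmptyElim y
    have h0' : spanNum f univ n (2 * ε) = 0 := by simpa using h0
    rw [h0', Nat.cast_zero]
    positivity
  let pt : Set X → X := fun V => Classical.epsilon (· ∈ V)
  have hs : Spans f univ ((E.biUnion 𝒱).image pt) n (2 * ε) := by
    intro x _
    obtain ⟨y, hy, hyx⟩ := hE (π x) trivial
    obtain ⟨V, hV, hxV⟩ := h𝒱cov y x hyx
    exact ⟨pt V, Finset.mem_image_of_mem _ (Finset.mem_biUnion.2 ⟨y, hy, hV⟩),
      h𝒱diam y V hV _ (Classical.epsilon_spec (p := (· ∈ V)) ⟨x, hxV⟩) x hxV⟩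
  calc (spanNum f univ n (2 * ε) : ℝ)
      ≤ ((E.biUnion 𝒱).card : ℝ) :=
        Nat.cast_le.2 (hs.spanNum_le_card.trans Finset.card_image_le)
    _ ≤ ∑ y ∈ E, ((𝒱 y).card : ℝ) := by exact_mod_cast Finset.card_biUnion_le
    _ ≤ ∑ _y ∈ E, Real.exp (α * (n + t.sup m)) := Finset.sum_le_sum fun y _ => h𝒱card y
    _ = _ := by rw [Finset.sum_const, nsmul_eq_mul, hEcard]

/-- Bowen's fibered entropy inequality, for fibers of entropy less than `α`. -/
theorem entropyOn_univ_le_add_of_fiber_lt {X Y : Type*} [MetricSpace X] [CompactSpace X]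
    [MetricSpace Y] [CompactSpace Y] {f : X → X} {g : Y → Y} {π : X → Y}
    (hf : Continuous f) (hg : Continuous g) (hπ : Continuous π)
    (hcomm : Function.Semiconj π f g) {α : ℝ} (hα : 0 ≤ α)
    (hfib : ∀ y, entropyOn f (π ⁻¹' {y}) < α) :
    entropyOn f univ ≤ entropyOn g univ + α := by
  refine iSup₂_le fun ε hε => ?_
  obtain ⟨δ, hδ, M, h⟩ := exists_spanNum_le_mul_exp hf hg hπ hcomm hα hfib (half_pos hε)
  rw [mul_div_cancel₀ ε two_ne_zero] at h
  let b : ℕ → EReal := fun n => ((α + α * M / n : ℝ) : EReal)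
  have hb : atTop.limsup b = α := by
    have : Tendsto (fun n : ℕ => α + α * M / n) atTop (nhds (α + 0)) :=
      tendsto_const_nhds.add (tendsto_const_div_atTop_nhds_zero_nat _)
    rw [add_zero] at this
    exact (EReal.tendsto_coe.2 this).limsup_eq
  let a : ℕ → EReal := fun n => ((Real.log (spanNum g univ n δ) / n : ℝ) : EReal)
  have hab : ∀ᶠ n : ℕ in atTop,
      ((Real.log (spanNum f univ n ε) / n : ℝ) : EReal) ≤ (a + b) n := by
    filter_upwards [eventually_gt_atTop 0] with n hn
    have hn' : (0 : ℝ) < n := by exact_mod_cast hn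
    have hlog : Real.log (spanNum f univ n ε) ≤
        Real.log (spanNum g univ n δ) + α * (n + M) := by
      rcases Nat.eq_zero_or_pos (spanNum f univ n ε) with h0 | h0
      · rw [h0, Nat.cast_zero, Real.log_zero]
        exact add_nonneg (Real.log_natCast_nonneg _) (by positivity)
      · have hg0 : (spanNum g univ n δ : ℝ) ≠ 0 := by
          intro hz
          have := h n
          rw [hz, zero_mul] at this
          exact absurd (Nat.cast_pos.2 h0) this.not_gt
        rw [← Real.log_exp (α * (n + M)), ← Real.log_mul hg0 (Real.exp_ne_zero _)]
        exact Real.log_le_log (by exact_mod_cast h0) (h n)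
    have : Real.log (spanNum f univ n ε) / n ≤
        Real.log (spanNum g univ n δ) / n + (α + α * M / n) := by
      rw [div_le_iff₀ hn']
      field_simp
      linarith
    simpa [a, b] using EReal.coe_le_coe_iff.2 this
  calc atTop.limsup (fun n : ℕ => ((Real.log (spanNum f univ n ε) / n : ℝ) : EReal))
      ≤ atTop.limsup (a + b) := limsup_le_limsup hab
    _ ≤ atTop.limsup a + atTop.limsup b :=
        EReal.limsup_add_le (Or.inr (hb ▸ EReal.coe_ne_top α)) (Or.inr (hb ▸ EReal.coe_ne_bot α))
    _ ≤ entropyOn g univ + α := by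
        rw [hb]
        gcongr
        exact le_iSup₂ (f := fun (δ : ℝ) (_ : 0 < δ) =>
          atTop.limsup fun n : ℕ => ((Real.log (spanNum g univ n δ) / n : ℝ) : EReal)) δ hδ

/-- If `π` semi-conjugates `f : X → X` with `g : Y → Y` (all spaces compact metric)
and every fiber `π⁻¹({y})` carries zero entropy for `f`, then `h(f) = h(g)`. -/
theorem stmt7 {X Y : Type*} [MetricSpace X] [CompactSpace X]
    [MetricSpace Y] [CompactSpace Y]
    (f : X → X) (g : Y → Y) (π : X → Y)
    (hf : Continuous f) (hg : Continuous g) (hπ : Continuous π)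
    (hsurj : Function.Surjective π) (hcomm : π ∘ f = g ∘ π)
    (hfib : ∀ y : Y, entropyOn f (π ⁻¹' {y}) = 0) :
    entropyOn f Set.univ = entropyOn g Set.univ := by
  have hsemi : Function.Semiconj π f g := congrFun hcomm
  refine le_antisymm ?_ (entropyOn_univ_le_of_semiconj hf hπ hsurj hsemi)
  have hadd : ∀ α : ℝ, 0 < α → entropyOn f univ ≤ entropyOn g univ + α := fun α hα =>
    entropyOn_univ_le_add_of_fiber_lt hf hg hπ hsemi hα.le fun y => by
      rw [hfib y]; exact_mod_cast hα
  have hlim : Tendsto (fun α : ℝ => entropyOn g univ + (α : EReal)) (nhdsWithin 0 (Ioi 0))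
      (nhds (entropyOn g univ + ((0 : ℝ) : EReal))) := by
    have hc : ContinuousAt (fun p : EReal × EReal => p.1 + p.2)
        (entropyOn g univ, ((0 : ℝ) : EReal)) :=
      EReal.continuousAt_add (Or.inr (EReal.coe_ne_bot 0)) (Or.inr (EReal.coe_ne_top 0))
    exact hc.tendsto.comp (tendsto_const_nhds.prodMk_nhds
      ((continuous_coe_real_ereal.tendsto 0).mono_left nhdsWithin_le_nhds))
  rw [EReal.coe_zero, add_zero] at hlim
  exact ge_of_tendsto hlim (eventually_mem_nhdsWithin.mono hadd)
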